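/- arXiv:2508.20544 — 7 statements merged into one kernel-verified Lean document; each statement's English description precedes it below -/
import Mathlib

section
/- Let n ≥ 1 and let W ∈ ℝ^{n×n} be an invertible matrix with columns w_1, …, w_n. Then there exists an input sequence u_1, …, u_{n²} ∈ ℝ^n such that the Jacobian J ∈ ℝ^{n²×n²} of the observability mapping, whose entry in row i and column (j−1)n + l equals χ(w_jᵀ u_i)·(u_i)_l, has full rank n² (i.e., J is invertible). (Theorem 1: a two-layer ReLU FNN with m = n inputs and an invertible weight matrix satisfies the observability rank condition, hence is locally observable.) -/
open Matrix

/-- The entrywise indicator: `χ(a) = 1` if `a > 0`, `0` otherwise. -/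
noncomputable def chi (a : ℝ) : ℝ := if 0 < a then 1 else 0

/-- The input attached to `(j, k)`: row `j` of `B` if `k = j`, otherwise row `j` minus row `k`. -/
def rowDiffInput {n : ℕ} (B : Matrix (Fin n) (Fin n) ℝ) (jk : Fin n × Fin n) : Fin n → ℝ :=
  if jk.2 = jk.1 then B jk.1 else B jk.1 - B jk.2

/-- If `B` is a left inverse of `W`, the input attached to `(j, k)` activates exactly the
neuron `j`. -/
lemma chi_dotProduct_rowDiffInput {n : ℕ} {W B : Matrix (Fin n) (Fin n) ℝ} (hBW : B * W = 1)
    (i j k : Fin n) :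
    chi ((fun l => W l i) ⬝ᵥ rowDiffInput B (j, k)) = if i = j then 1 else 0 := by
  have hdot (a : Fin n) : (fun l => W l i) ⬝ᵥ B a = if a = i then 1 else 0 := by
    rw [dotProduct_comm, ← Matrix.one_apply, ← hBW]
    rfl
  unfold chi rowDiffInput
  split_ifs <;> simp_all [dotProduct_sub] <;> grind

/-- **Theorem 1.** For any `n ≥ 1` and invertible `W ∈ ℝ^{n×n}` (with columns `w_j`),
there exists an input sequence `u_1, …, u_{n²}` such that the Jacobian of the
observability mapping, with entry `χ(w_jᵀ u_i) · (u_i)_l` in row `i` and column `(j,l)`,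
has full rank `n²`. -/
theorem stmt0 (n : ℕ) (hn : 1 ≤ n) (W : Matrix (Fin n) (Fin n) ℝ)
    (hW : IsUnit W.det) :
    ∃ u : Fin (n * n) → (Fin n → ℝ),
      (Matrix.of fun (i : Fin (n * n)) (jl : Fin n × Fin n) =>
        chi ((fun l => W l jl.1) ⬝ᵥ u i) * u i jl.2).rank = n * n := by
  have hinv : W⁻¹ * W = 1 := nonsing_inv_mul W hW
  obtain ⟨e⟩ : Nonempty (Fin (n * n) ≃ Fin n × Fin n) := ⟨finProdFinEquiv.symm⟩
  refine ⟨fun i => rowDiffInput W⁻¹ (e i), ?_⟩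
  rw [Matrix.rank, LinearMap.finrank_range_of_inj]
  · simp
  rw [← LinearMap.ker_eq_bot, LinearMap.ker_eq_bot']
  intro v hv
  have hrow (j k : Fin n) : rowDiffInput W⁻¹ (j, k) ⬝ᵥ (fun l => v (j, l)) = 0 := by
    have h := congrFun hv (e.symm (j, k))
    simpa [mulVec, dotProduct.eq_1 _ v, dotProduct.eq_1 _ fun l => v (j, l),
      Fintype.sum_prod_type, chi_dotProduct_rowDiffInput hinv] using h
  have hzero (j : Fin n) : W⁻¹ *ᵥ (fun l => v (j, l)) = 0 := by
    have hj : W⁻¹ j ⬝ᵥ (fun l => v (j, l)) = 0 := by simpa [rowDiffInput] using hrow j j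
    funext k
    by_cases hkj : k = j
    · exact hkj ▸ hj
    · have h := hrow j k
      rwa [rowDiffInput, if_neg hkj, sub_dotProduct, hj, zero_sub, neg_eq_zero] at h
  have hmul : W * W⁻¹ = 1 := mul_nonsing_inv W hW
  funext ⟨j, l⟩
  have h := congrArg (W *ᵥ ·) (hzero j)
  simp only [mulVec_mulVec, hmul, one_mulVec, mulVec_zero] at h
  exact congrFun h l
end

section
/- Let n ≥ 1, N = n², and let W ∈ ℝ^{n×n} be invertible with columns w_1, …, w_n. Let B ∈ ℝ^{N×n} be partitioned into n vertically stacked blocks B_1, …, B_n ∈ ℝ^{n×n} such that (i) each B_k is invertible, and (ii) there exists an invertible matrix T ∈ ℝ^{n×n} all of whose entries lie in {0,1} with χ(B) = T ⊗ 𝟏_n (i.e., χ(B_{(k−1)n+i, j}) = T_{k,j} for all k, j ∈ {1,…,n} and i ∈ {1,…,n}). Define U = B W^{−1} and let u_iᵀ denote the i-th row of U. Then the Jacobian J ∈ ℝ^{n²×n²} of the observability mapping at W under the input sequence u_1, …, u_N, whose entry in row i and column (j−1)n + l equals χ(w_jᵀ u_i)·(u_i)_l, has full rank n². (Theorem 2: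 such input sequences are persistently exciting.) -/
open Matrix

open scoped Kronecker in
/-- The matrix obtained by stacking the block rows `[T k 1 • C k, …, T k n • C k]` factors as a
block diagonal matrix times `T ⊗ₖ 1`; it is invertible when `T` and all the `C k` are. -/
theorem isUnit_det_of_mul_block {ι κ R : Type*} [Fintype ι] [DecidableEq ι] [Fintype κ]
    [DecidableEq κ] [CommRing R] (T : Matrix κ κ R) (hT : IsUnit T.det)
    (C : κ → Matrix ι ι R) (hC : ∀ k, IsUnit (C k).det) :
    IsUnit (Matrix.of fun (p q : κ × ι) => T p.1 q.1 * C p.1 p.2 q.2).det := by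
  have factor : (Matrix.of fun (p q : κ × ι) => T p.1 q.1 * C p.1 p.2 q.2) =
      (blockDiagonal C).submatrix (Equiv.prodComm κ ι) (Equiv.prodComm κ ι) *
        (T ⊗ₖ (1 : Matrix ι ι R)) := by
    ext ⟨k, i⟩ ⟨j, l⟩
    simp [Matrix.mul_apply, Fintype.sum_prod_type, blockDiagonal_apply, Matrix.one_apply,
      mul_comm]
  rw [factor, det_mul, det_submatrix_equiv_self, det_blockDiagonal, det_kronecker, det_one,
    one_pow, mul_one]
  exact (IsUnit.prod_univ_iff.2 hC).mul (hT.pow _)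

/-- **Theorem 2.** Let `N = n²`, `W ∈ ℝ^{n×n}` invertible, and `B ∈ ℝ^{N×n}` consist of
`n` vertically stacked invertible blocks `B_1, …, B_n` (row `(k,i)` of `B` is row `i` of
block `B_k`) with `χ(B) = T ⊗ 𝟏_n` for an invertible `0/1`-matrix `T`.  Then the input
`U = B W⁻¹` (with rows `u_iᵀ`) makes the Jacobian of the observability mapping at `W`
(entry `χ(w_jᵀ u_i) · (u_i)_l = χ((UW)_{i,j}) · U_{i,l}` in row `i`, column `(j,l)`)
have full rank `n²`. -/
theorem stmt1 (n : ℕ) (hn : 1 ≤ n) (W : Matrix (Fin n) (Fin n) ℝ) (hW : IsUnit W.det)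
    (B : Fin n → Matrix (Fin n) (Fin n) ℝ) (hB : ∀ k, IsUnit (B k).det)
    (T : Matrix (Fin n) (Fin n) ℝ) (hT : IsUnit T.det)
    (hT01 : ∀ k j, T k j = 0 ∨ T k j = 1)
    (hchi : ∀ k i j, chi (B k i j) = T k j)
    (U : Matrix (Fin n × Fin n) (Fin n) ℝ)
    (hU : U = (Matrix.of fun (p : Fin n × Fin n) j => B p.1 p.2 j) * W⁻¹) :
    (Matrix.of fun (i : Fin n × Fin n) (jl : Fin n × Fin n) =>
      chi ((U * W) i jl.1) * U i jl.2).rank = n * n := by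
  have hUW : U * W = Matrix.of fun (p : Fin n × Fin n) j => B p.1 p.2 j := by
    rw [hU, nonsing_inv_mul_cancel_right _ _ hW]
  have hJ : (Matrix.of fun (i : Fin n × Fin n) (jl : Fin n × Fin n) =>
      chi ((U * W) i jl.1) * U i jl.2) =
      Matrix.of fun (p q : Fin n × Fin n) => T p.1 q.1 * (B p.1 * W⁻¹) p.2 q.2 := by
    ext p q
    rw [hUW]
    simp [hchi, hU, Matrix.mul_apply]
  have hdet := isUnit_det_of_mul_block T hT (fun k => B k * W⁻¹) fun k => by
    rw [det_mul]
    exact (hB k).mul (isUnit_nonsing_inv_det W hW)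
  rw [hJ, rank_of_isUnit _ ((isUnit_iff_isUnit_det _).2 hdet), Fintype.card_prod, Fintype.card_fin]
end

section
/- Let n ≥ 1, N = n², and let W ∈ ℝ^{n×n} be invertible. Let B ∈ ℝ^{N×n} have vertically stacked blocks B_1, …, B_n ∈ ℝ^{n×n}, each invertible, such that χ(B) = T ⊗ 𝟏_n for some invertible T ∈ ℝ^{n×n} with entries in {0,1}, and define U = B W^{−1}. Suppose δ ∈ ℝ^{n×n} and K ∈ ℝ^{N×n} satisfy: every entry of K is strictly greater than −1, and U δ = K ∘ (U W), where ∘ denotes the entrywise (Hadamard) product. Set W′ = W + δ with columns w′_1, …, w′_n. Then the Jacobian J′ ∈ ℝ^{n²×n²} of the observability mapping at W′ under the same input sequence (rows of U), whose entry in row i and column (j−1)n + l equals χ(w′_jᵀ u_i)·(u_i)_l, has full rank n². (Theorem 3: the same persistently exciting input excites all weights W′ in this neighborhood of W.) -/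
open Matrix

theorem chi_one_add_mul {k : ℝ} (hk : -1 < k) (b : ℝ) : chi ((1 + k) * b) = chi b := by
  have h : 0 < 1 + k := by linarith
  simp only [chi, mul_pos_iff_of_pos_left h]

/-- A stack of invertible blocks `C k`, weighted blockwise by an invertible matrix `T`, has full
rank. -/
theorem rank_weighted_blocks {ι κ R : Type*} [Fintype ι] [DecidableEq ι] [Fintype κ]
    [DecidableEq κ] [Field R] (T : Matrix κ κ R) (hT : IsUnit T.det) (C : κ → Matrix ι ι R)
    (hC : ∀ k, IsUnit (C k).det) :
    (Matrix.of fun (i jl : κ × ι) => T i.1 jl.1 * C i.1 i.2 jl.2).rank =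
      Fintype.card (κ × ι) := by
  apply Matrix.rank_of_isUnit
  rw [Matrix.isUnit_iff_isUnit_det]
  refine Matrix.isUnit_det_of_left_inverse
    (B := Matrix.of fun jl i => T⁻¹ jl.1 i.1 * (C i.1)⁻¹ jl.2 i.2) ?_
  ext ⟨j, l⟩ ⟨j', l'⟩
  have hblock (k : κ) : ∑ i, (C k)⁻¹ l i * C k i l' = (1 : Matrix ι ι R) l l' := by
    rw [← Matrix.mul_apply, Matrix.nonsing_inv_mul _ (hC k)]
  have hT' : ∑ k, T⁻¹ j k * T k j' = (1 : Matrix κ κ R) j j' := by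
    rw [← Matrix.mul_apply, Matrix.nonsing_inv_mul _ hT]
  simp only [Matrix.mul_apply, Matrix.of_apply, Fintype.sum_prod_type, mul_mul_mul_comm,
    ← Finset.mul_sum, hblock, ← Finset.sum_mul, hT']
  simp only [Matrix.one_apply, Prod.mk.injEq, mul_ite, mul_one, mul_zero, ite_and]
  split_ifs <;> rfl

/-- **Theorem 3.** With `N = n²`, `W` invertible, `B` a stack of invertible blocks with
`χ(B) = T ⊗ 𝟏_n` for an invertible `0/1`-matrix `T`, and `U = B W⁻¹`: if `δ` and `K`
satisfy that every entry of `K` is `> −1` and `Uδ = K ∘ (UW)` (Hadamard product),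
then for `W′ = W + δ` (columns `w′_j`) the Jacobian of the observability mapping at `W′`
under the same inputs (rows of `U`), with entry `χ(w′_jᵀ u_i) · (u_i)_l
= χ((UW′)_{i,j}) · U_{i,l}`, has full rank `n²`. -/
theorem stmt2 (n : ℕ) (hn : 1 ≤ n) (W : Matrix (Fin n) (Fin n) ℝ) (hW : IsUnit W.det)
    (B : Fin n → Matrix (Fin n) (Fin n) ℝ) (hB : ∀ k, IsUnit (B k).det)
    (T : Matrix (Fin n) (Fin n) ℝ) (hT : IsUnit T.det)
    (hT01 : ∀ k j, T k j = 0 ∨ T k j = 1)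
    (hchi : ∀ k i j, chi (B k i j) = T k j)
    (U : Matrix (Fin n × Fin n) (Fin n) ℝ)
    (hU : U = (Matrix.of fun (p : Fin n × Fin n) j => B p.1 p.2 j) * W⁻¹)
    (δ : Matrix (Fin n) (Fin n) ℝ) (K : Matrix (Fin n × Fin n) (Fin n) ℝ)
    (hK : ∀ i j, -1 < K i j)
    (hKδ : U * δ = Matrix.hadamard K (U * W))
    (W' : Matrix (Fin n) (Fin n) ℝ) (hW' : W' = W + δ) :
    (Matrix.of fun (i : Fin n × Fin n) (jl : Fin n × Fin n) =>
      chi ((U * W') i jl.1) * U i jl.2).rank = n * n := by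
  have hUW : U * W = Matrix.of fun (p : Fin n × Fin n) j => B p.1 p.2 j := by
    rw [hU, Matrix.nonsing_inv_mul_cancel_right _ _ hW]
  have hact (p : Fin n × Fin n) (j : Fin n) : chi ((U * W') p j) = T p.1 j := by
    rw [← hchi p.1 p.2 j, ← chi_one_add_mul (hK p j) (B p.1 p.2 j), hW', Matrix.mul_add, hKδ, hUW]
    simp only [Matrix.add_apply, Matrix.hadamard_apply, Matrix.of_apply]
    congr 1
    ring
  have hblock (p : Fin n × Fin n) (l : Fin n) : U p l = (B p.1 * W⁻¹) p.2 l := by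
    simp only [hU, Matrix.mul_apply, Matrix.of_apply]
  simp only [hact, hblock]
  rw [rank_weighted_blocks T hT (fun k => B k * W⁻¹) fun k => ?_]
  · simp
  · rw [Matrix.det_mul]
    exact (hB k).mul (Matrix.isUnit_nonsing_inv_det _ hW)
end

section
/- Let n ≥ 1, N = n², and let W ∈ ℝ^{n×n} be invertible with columns w_1, …, w_n. For k ∈ {1, …, n}, let B_k ∈ ℝ^{n×n} be the matrix with (B_k)_{i,k} = 1 for all i, (B_k)_{i,i} = −1 for i ≠ k, and all other entries 0; let B ∈ ℝ^{N×n} be the vertical stack of B_1, …, B_n, and set U = B W^{−1} with i-th row u_iᵀ. Then: (a) for all i ∈ {1,…,N} and j ∈ {1,…,n}, χ(w_jᵀ u_i) = 1 if and only if (k−1)n < i ≤ kn with k = j; (b) consequently the Jacobian J ∈ ℝ^{n²×n²} of the observability mapping at W under u_1, …, u_N is block diagonal with n diagonal blocks H_1, …, H_n ∈ ℝ^{n×n}, where H_k = B_k W^{−1} (its rows being u_{(k−1)n+1}ᵀ, …, u_{kn}ᵀ); and (c) each block H_k is invertible. -/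
open Matrix

/-- The matrix with `k`-th column all ones, diagonal `-1` outside that column, and `0` elsewhere
is an involution. -/
theorem mul_self_of_ones_column {n : ℕ} (A : Matrix (Fin n) (Fin n) ℝ) (k : Fin n)
    (hA : ∀ i j, A i j = if j = k then 1 else if i = j then -1 else 0) : A * A = 1 := by
  have hmulVec (v : Fin n → ℝ) (i : Fin n) :
      (A *ᵥ v) i = v k - if i = k then 0 else v i := by
    have hterm (j : Fin n) : A i j * v j =
        (if j = k then v k else 0) - if j = i then (if i = k then 0 else v i) else 0 := by
      rw [hA]
      grind
    simp [Matrix.mulVec, dotProduct, hterm, Finset.sum_sub_distrib]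
  refine Matrix.ext_of_mulVec_single fun j => ?_
  funext i
  rw [← Matrix.mulVec_mulVec, hmulVec, hmulVec, hmulVec, Matrix.one_mulVec]
  grind

/-- **Construction in the proof of Theorem 1.** Let `W ∈ ℝ^{n×n}` be invertible and,
for each `k`, let `B_k` be the matrix with `k`-th column all ones, diagonal `−1`
outside the `k`-th column, and `0` elsewhere.  Stack the `B_k` into `B ∈ ℝ^{n²×n}`
(row `(k,i)` of `B` is row `i` of `B_k`) and set `U = B W⁻¹` with rows `u_{(k,i)}ᵀ`.
Then (a) `χ(w_jᵀ u_{(k,i)}) = 1` iff `j = k` (i.e. iff the row lies in the `k = j`-th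
block); (b) the Jacobian `J` of the observability mapping at `W` (entry
`χ(w_jᵀ u_p)·(u_p)_l = χ((UW)_{p,j})·U_{p,l}` in row `p = (k,i)`, column `(j,l)`)
is block diagonal with diagonal blocks `H_k = B_k W⁻¹`; and (c) each `H_k` is
invertible. -/
theorem stmt5 (n : ℕ) (hn : 1 ≤ n) (W : Matrix (Fin n) (Fin n) ℝ) (hW : IsUnit W.det)
    (B : Fin n → Matrix (Fin n) (Fin n) ℝ)
    (hB : ∀ k i j, B k i j = if j = k then 1 else if i = j then -1 else 0)
    (U : Matrix (Fin n × Fin n) (Fin n) ℝ)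
    (hU : U = (Matrix.of fun (p : Fin n × Fin n) j => B p.1 p.2 j) * W⁻¹) :
    (∀ (p : Fin n × Fin n) (j : Fin n), chi ((U * W) p j) = 1 ↔ p.1 = j) ∧
    (∀ (p jl : Fin n × Fin n),
      chi ((U * W) p jl.1) * U p jl.2
        = if p.1 = jl.1 then (B jl.1 * W⁻¹) p.2 jl.2 else 0) ∧
    (∀ k, IsUnit (B k * W⁻¹).det) := by
  have hUW : U * W = Matrix.of fun (p : Fin n × Fin n) j => B p.1 p.2 j := by
    rw [hU, Matrix.nonsing_inv_mul_cancel_right _ _ hW]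
  have hchi (p : Fin n × Fin n) (j : Fin n) :
      chi ((U * W) p j) = if p.1 = j then 1 else 0 := by
    rw [hUW, Matrix.of_apply, hB, chi]
    grind
  refine ⟨fun p j => by simp [hchi], fun p jl => ?_, fun k => ?_⟩
  · rw [hchi, ite_mul, one_mul, zero_mul]
    refine if_ctx_congr Iff.rfl (fun h => ?_) fun _ => rfl
    rw [hU, ← h]
    rfl
  · rw [Matrix.det_mul]
    exact (Matrix.isUnit_det_of_left_inverse (mul_self_of_ones_column (B k) k (hB k))).mul
      (Matrix.isUnit_nonsing_inv_det W hW)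
end

section
/- Consider a single-input two-layer ReLU FNN (m = 1) with weight vector w ∈ ℝ^n, n ≥ 2, and output h(w,u) = Σ_{j=1}^n max(0, w_j u) for u ∈ ℝ. Suppose there exist indices p ≠ q with w_p · w_q > 0 (i.e., w_p and w_q are nonzero and have the same sign). Then for every ε > 0 there exists w′ ∈ ℝ^n with w′ ≠ w, ‖w′ − w‖ < ε, and h(w′, u) = h(w, u) for every u ∈ ℝ. In particular, the weights w cannot be distinguished from arbitrarily close weights by any input sequence. -/
/-- On weights of one sign, the summed output of two ReLU neurons depends only on the sum of the
weights. -/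
theorem max_zero_mul_add_max_zero_mul_of_nonneg {a b : ℝ} (ha : 0 ≤ a) (hb : 0 ≤ b) (u : ℝ) :
    max 0 (a * u) + max 0 (b * u) = max 0 ((a + b) * u) := by
  rcases le_total 0 u with hu | hu
  · rw [max_eq_right (mul_nonneg ha hu), max_eq_right (mul_nonneg hb hu),
      max_eq_right (mul_nonneg (add_nonneg ha hb) hu), add_mul]
  · rw [max_eq_left (mul_nonpos_of_nonneg_of_nonpos ha hu),
      max_eq_left (mul_nonpos_of_nonneg_of_nonpos hb hu),
      max_eq_left (mul_nonpos_of_nonneg_of_nonpos (add_nonneg ha hb) hu), add_zero]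

theorem max_zero_mul_add_max_zero_mul_of_nonpos {a b : ℝ} (ha : a ≤ 0) (hb : b ≤ 0) (u : ℝ) :
    max 0 (a * u) + max 0 (b * u) = max 0 ((a + b) * u) := by
  have h := max_zero_mul_add_max_zero_mul_of_nonneg (neg_nonneg.2 ha) (neg_nonneg.2 hb) (-u)
  rwa [neg_mul_neg, neg_mul_neg, ← neg_add, neg_mul_neg] at h

/-- Shifting a small amount of weight between two ReLU neurons of the same sign preserves their
summed output. -/
theorem max_zero_add_mul_add_max_zero_sub_mul {a b t : ℝ} (hab : 0 < a * b) (ht : 0 ≤ t)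
    (hta : t ≤ |a|) (htb : t ≤ |b|) (u : ℝ) :
    max 0 ((a + t) * u) + max 0 ((b - t) * u) = max 0 (a * u) + max 0 (b * u) := by
  have hsum : a + t + (b - t) = a + b := by ring
  rcases pos_and_pos_or_neg_and_neg_of_mul_pos hab with ⟨ha, hb⟩ | ⟨ha, hb⟩
  · rw [abs_of_pos hb] at htb
    rw [max_zero_mul_add_max_zero_mul_of_nonneg (by linarith) (by linarith), hsum,
      max_zero_mul_add_max_zero_mul_of_nonneg ha.le hb.le]
  · rw [abs_of_neg ha] at hta
    rw [max_zero_mul_add_max_zero_mul_of_nonpos (by linarith) (by linarith), hsum,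
      max_zero_mul_add_max_zero_mul_of_nonpos ha.le hb.le]

/-- **Motivating example (same-sign weights).** For a single-input two-layer ReLU FNN
with weights `w ∈ ℝ^n`, `n ≥ 2`, and output `h(w,u) = Σ_j max(0, w_j u)`: if two
weights `w_p, w_q` (`p ≠ q`) are nonzero with the same sign (`w_p w_q > 0`), then
arbitrarily close to `w` there are different weights `w′` producing the same output
for every input. -/
theorem stmt6 (n : ℕ) (hn : 2 ≤ n) (w : EuclideanSpace ℝ (Fin n))
    (p q : Fin n) (hpq : p ≠ q) (hw : 0 < w p * w q) :
    ∀ ε > 0, ∃ w' : EuclideanSpace ℝ (Fin n), w' ≠ w ∧ ‖w' - w‖ < ε ∧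
      ∀ u : ℝ, (∑ j, max 0 (w' j * u)) = ∑ j, max 0 (w j * u) := by
  intro ε hε
  have hp : w p ≠ 0 := left_ne_zero_of_mul hw.ne'
  have hq : w q ≠ 0 := right_ne_zero_of_mul hw.ne'
  obtain ⟨t, ht, htlt⟩ : ∃ t, 0 < t ∧ t < min (ε / 2) (min |w p| |w q|) :=
    exists_between (lt_min (half_pos hε) (lt_min (abs_pos.2 hp) (abs_pos.2 hq)))
  obtain ⟨htε, htp, htq⟩ : t < ε / 2 ∧ t < |w p| ∧ t < |w q| := by
    simpa only [lt_min_iff] using htlt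
  set d : EuclideanSpace ℝ (Fin n) := EuclideanSpace.single p t - EuclideanSpace.single q t with hd
  have hdp : d p = t := by simp [hd, hpq]
  have hdq : d q = -t := by simp [hd, hpq.symm]
  have hdj : ∀ j, j ≠ p ∧ j ≠ q → d j = 0 := fun j hj => by simp [hd, hj.1, hj.2]
  refine ⟨w + d, fun h => ?_, ?_, fun u => ?_⟩
  · rw [add_eq_left.1 h] at hdp
    exact ht.ne hdp
  · rw [add_sub_cancel_left]
    calc ‖d‖ ≤ ‖EuclideanSpace.single p t‖ + ‖EuclideanSpace.single q t‖ := norm_sub_le _ _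
      _ = t + t := by simp [abs_of_pos ht]
      _ < ε := by linarith
  · rw [← sub_eq_zero, ← Finset.sum_sub_distrib, Fintype.sum_eq_add p q hpq]
    · have h := max_zero_add_mul_add_max_zero_sub_mul hw ht.le htp.le htq.le u
      rw [PiLp.add_apply, PiLp.add_apply, hdp, hdq, ← sub_eq_add_neg]
      linarith
    · intro j hj
      rw [PiLp.add_apply, hdj j hj, add_zero, sub_self]
end

section
/- Consider a single-input two-layer ReLU FNN (m = 1) with weight vector w ∈ ℝ^n, n ≥ 3, and output h(w,u) = Σ_{j=1}^n max(0, w_j u) for u ∈ ℝ. If all entries of w are nonzero, then for every ε > 0 there exists w′ ∈ ℝ^n with w′ ≠ w, ‖w′ − w‖ < ε, and h(w′, u) = h(w, u) for every u ∈ ℝ. (Hence any FNN with m = 1 and n ≥ 3 nonzero weights has indistinguishable weights and is not locally observable.) -/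
/-- A perturbation smaller than the weight changes the output of a ReLU unit linearly, with a
slope depending only on the sign of the weight. -/
theorem max_zero_add_mul_of_abs_lt {a d : ℝ} (h : |d| < |a|) (u : ℝ) :
    max 0 ((a + d) * u) = max 0 (a * u) + d * (if 0 < a then max 0 u else min 0 u) := by
  obtain ⟨h₁, h₂⟩ := abs_lt.mp h
  split_ifs with ha
  · rw [abs_of_pos ha] at h₁ h₂
    rcases le_total 0 u with hu | hu
    · rw [max_eq_right hu, max_eq_right (mul_nonneg ha.le hu),
        max_eq_right (mul_nonneg (by linarith) hu)]
      ring
    · rw [max_eq_left hu, max_eq_left (mul_nonpos_of_nonneg_of_nonpos ha.le hu),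
        max_eq_left (mul_nonpos_of_nonneg_of_nonpos (by linarith) hu)]
      ring
  · rw [not_lt] at ha
    rw [abs_of_nonpos ha] at h₁ h₂
    rcases le_total 0 u with hu | hu
    · rw [min_eq_left hu, max_eq_left (mul_nonpos_of_nonpos_of_nonneg ha hu),
        max_eq_left (mul_nonpos_of_nonpos_of_nonneg (by linarith) hu)]
      ring
    · rw [min_eq_right hu, max_eq_right (mul_nonneg_of_nonpos_of_nonpos ha hu),
        max_eq_right (mul_nonneg_of_nonpos_of_nonpos (by linarith) hu)]
      ring

/-- **Motivating example.** For a single-input two-layer ReLU FNN with weights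
`w ∈ ℝ^n`, `n ≥ 3`, output `h(w,u) = Σ_j max(0, w_j u)`, and all weights nonzero:
arbitrarily close to `w` there are different weights `w′` producing the same output
for every input `u ∈ ℝ`; hence `w` is not locally observable. -/
theorem stmt7 (n : ℕ) (hn : 3 ≤ n) (w : EuclideanSpace ℝ (Fin n))
    (hw : ∀ j, w j ≠ 0) :
    ∀ ε > 0, ∃ w' : EuclideanSpace ℝ (Fin n), w' ≠ w ∧ ‖w' - w‖ < ε ∧
      ∀ u : ℝ, (∑ j, max 0 (w' j * u)) = ∑ j, max 0 (w j * u) := by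
  intro ε hε
  obtain ⟨i, k, hik, hsign⟩ : ∃ i k, i ≠ k ∧ decide (0 < w i) = decide (0 < w k) :=
    Fintype.exists_ne_map_eq_of_card_lt (fun j => decide (0 < w j)) (by simp; omega)
  have hsign : 0 < w i ↔ 0 < w k := decide_eq_decide.mp hsign
  obtain ⟨t, ht, htm⟩ := exists_between (a₁ := 0) (a₂ := min (ε / 2) (min |w i| |w k|))
    (lt_min (half_pos hε) (lt_min (abs_pos.mpr (hw i)) (abs_pos.mpr (hw k))))
  obtain ⟨htε, hti, htk⟩ : t < ε / 2 ∧ t < |w i| ∧ t < |w k| := by simpa using htm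
  let v : EuclideanSpace ℝ (Fin n) := EuclideanSpace.single i t - EuclideanSpace.single k t
  have hvi : v i = t := by simp [v, hik]
  have hvk : v k = -t := by simp [v, hik.symm]
  have hv0 (j) (hi : j ≠ i) (hk : j ≠ k) : v j = 0 := by simp [v, hi, hk]
  refine ⟨w + v, ?_, ?_, fun u => ?_⟩
  · intro h
    rw [add_eq_left] at h
    rw [h, PiLp.zero_apply] at hvi
    exact ht.ne hvi
  · rw [add_sub_cancel_left]
    refine (norm_sub_le _ _).trans_lt ?_
    rw [PiLp.norm_single, PiLp.norm_single, Real.norm_of_nonneg ht.le]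
    linarith
  · have hsum : ∑ j, v j = 0 := by simp [v]
    have key (j) : max 0 ((w + v) j * u) =
        max 0 (w j * u) + v j * (if 0 < w i then max 0 u else min 0 u) := by
      rw [PiLp.add_apply]
      rcases eq_or_ne j i with rfl | hi
      · exact max_zero_add_mul_of_abs_lt (by rwa [hvi, abs_of_pos ht]) u
      rcases eq_or_ne j k with rfl | hk
      · simp only [hsign]
        exact max_zero_add_mul_of_abs_lt (by rwa [hvk, abs_neg, abs_of_pos ht]) u
      · simp [hv0 j hi hk]
    simp only [key, Finset.sum_add_distrib, ← Finset.sum_mul, hsum, zero_mul, add_zero]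
end

section
/- Let n ≥ 1, N = n², and let W ∈ ℝ^{n×n} be invertible. Let B ∈ ℝ^{N×n} have vertically stacked blocks B_1, …, B_n ∈ ℝ^{n×n}, each invertible, such that χ(B) = T ⊗ 𝟏_n for some invertible T ∈ ℝ^{n×n} with entries in {0,1}, and suppose additionally that every entry of B is nonzero. Define U = B W^{−1} with i-th row u_iᵀ. Then there exists ε > 0 such that for every W′ ∈ ℝ^{n×n} (with columns w′_1, …, w′_n) satisfying ‖W′ − W‖ < ε, the Jacobian J′ ∈ ℝ^{n²×n²} of the observability mapping at W′ under the input sequence u_1, …, u_N, whose entry in row i and column (j−1)n + l equals χ(w′_jᵀ u_i)·(u_i)_l, has full rank n². (All weights in a neighborhood of W satisfy the observability rank condition under the single input sequence U.) -/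
open Matrix

/- Fix a matrix norm on `ℝ^{n×n}` (the entrywise sup norm). -/
attribute [local instance] Matrix.normedAddCommGroup

lemma eventually_chi_eq {a : ℝ} (ha : a ≠ 0) : ∀ᶠ b in nhds a, chi b = chi a := by
  rcases lt_or_gt_of_ne ha with h | h
  · filter_upwards [eventually_lt_nhds h] with b hb
    simp [chi, hb.not_gt, h.not_gt]
  · filter_upwards [eventually_gt_nhds h] with b hb
    simp [chi, hb, h]

/-- The matrix with `k`-th block row `T k · ⊗ C k` is a unit if `T` and all `C k` are. -/
lemma isUnit_of_block_rows {K m n : Type*} [Field K] [Fintype m] [DecidableEq m]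
    [Fintype n] [DecidableEq n] {C : m → Matrix n n K} (hC : ∀ k, IsUnit (C k))
    {T : Matrix m m K} (hT : IsUnit T) :
    IsUnit (Matrix.of fun (i jl : m × n) => T i.1 jl.1 * C i.1 i.2 jl.2) := by
  rw [← Matrix.mulVec_injective_iff_isUnit]
  refine (injective_iff_map_eq_zero (Matrix.mulVecLin _)).2 fun v hv => ?_
  have hCv : ∀ k, (fun l => ∑ j, T k j * v (j, l)) = 0 := fun k => by
    refine Matrix.mulVec_injective_iff_isUnit.2 (hC k) ?_
    rw [Matrix.mulVec_zero]
    ext i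
    have h := congrFun hv (k, i)
    simp only [Matrix.mulVecLin_apply, Matrix.mulVec, dotProduct, Matrix.of_apply,
      Fintype.sum_prod_type] at h
    rw [Finset.sum_comm] at h
    simp only [Matrix.mulVec, dotProduct, Finset.mul_sum]
    refine Eq.trans (Finset.sum_congr rfl fun l _ => Finset.sum_congr rfl fun j _ => ?_) h
    ring
  ext ⟨j, l⟩
  have hTv : (fun j => v (j, l)) = 0 := by
    refine Matrix.mulVec_injective_iff_isUnit.2 hT ?_
    rw [Matrix.mulVec_zero]
    ext k
    exact congrFun (hCv k) l
  exact congrFun hTv j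

/-- With `N = n²`, `W` invertible, `B` a vertical stack of invertible blocks
`B_1, …, B_n` (row `(k,i)` of `B` being row `i` of `B_k`) with all entries nonzero and
`χ(B) = T ⊗ 𝟏_n` for an invertible `0/1`-matrix `T`, and `U = B W⁻¹` (rows `u_iᵀ`):
there is `ε > 0` such that every `W′` with `‖W′ − W‖ < ε` makes the Jacobian of the
observability mapping at `W′` under the inputs `u_1, …, u_N` (entry
`χ(w′_jᵀ u_i)·(u_i)_l = χ((UW′)_{i,j})·U_{i,l}`) have full rank `n²`. -/
theorem stmt12 (n : ℕ) (hn : 1 ≤ n) (W : Matrix (Fin n) (Fin n) ℝ) (hW : IsUnit W.det)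
    (B : Fin n → Matrix (Fin n) (Fin n) ℝ) (hB : ∀ k, IsUnit (B k).det)
    (hBnz : ∀ k i j, B k i j ≠ 0)
    (T : Matrix (Fin n) (Fin n) ℝ) (hT : IsUnit T.det)
    (hT01 : ∀ k j, T k j = 0 ∨ T k j = 1)
    (hchi : ∀ k i j, chi (B k i j) = T k j)
    (U : Matrix (Fin n × Fin n) (Fin n) ℝ)
    (hU : U = (Matrix.of fun (p : Fin n × Fin n) j => B p.1 p.2 j) * W⁻¹) :
    ∃ ε > 0, ∀ W' : Matrix (Fin n) (Fin n) ℝ, ‖W' - W‖ < ε →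
      (Matrix.of fun (i : Fin n × Fin n) (jl : Fin n × Fin n) =>
        chi ((U * W') i jl.1) * U i jl.2).rank = n * n := by
  have hUW : ∀ k i j, (U * W) (k, i) j = B k i j := fun k i j => by
    rw [hU, Matrix.mul_assoc, Matrix.nonsing_inv_mul W hW, Matrix.mul_one, Matrix.of_apply]
  have hev : ∀ᶠ W' in nhds W, ∀ (i : Fin n × Fin n) (j : Fin n),
      chi ((U * W') i j) = T i.1 j := by
    refine Filter.eventually_all.2 fun i => Filter.eventually_all.2 fun j => ?_
    have hcont : Continuous fun W' : Matrix (Fin n) (Fin n) ℝ => (U * W') i j := by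
      simp only [Matrix.mul_apply]
      fun_prop
    have hne : (U * W) i j ≠ 0 := by
      rw [hUW]
      exact hBnz _ _ _
    filter_upwards [hcont.continuousAt.eventually (eventually_chi_eq hne)] with W' h
    rw [h, hUW, hchi]
  obtain ⟨ε, hε, hball⟩ := Metric.eventually_nhds_iff.1 hev
  refine ⟨ε, hε, fun W' hW' => ?_⟩
  have hchi' := hball (by rwa [dist_eq_norm])
  have hunit := isUnit_of_block_rows (C := fun k => B k * W⁻¹)
    (fun k => ((Matrix.isUnit_iff_isUnit_det _).2 (hB k)).mul
      ((Matrix.isUnit_iff_isUnit_det _).2 (Matrix.isUnit_nonsing_inv_det W hW)))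
    ((Matrix.isUnit_iff_isUnit_det T).2 hT)
  have hJ : (Matrix.of fun (i jl : Fin n × Fin n) => chi ((U * W') i jl.1) * U i jl.2) =
      Matrix.of fun (i jl : Fin n × Fin n) => T i.1 jl.1 * (B i.1 * W⁻¹) i.2 jl.2 := by
    ext i jl
    simp only [Matrix.of_apply, hchi']
    rw [hU]
    rfl
  rw [hJ, Matrix.rank_of_isUnit _ hunit, Fintype.card_prod, Fintype.card_fin]
end
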